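/- There exist universal constants c₁, c₂ > 0 such that for every Dyck prime σ whose associated ordered rooted tree D is binary (every node has at most two children), the minimum width of a simple re-pairing of σ satisfies c₁ · bw(D) ≤ (minimum width of a simple re-pairing of σ) ≤ c₂ · bw(D). -/

import Mathlib

/-- A Dyck word: entries ±1, total sum zero, all prefix sums nonnegative. -/
def IsDyck (w : List ℤ) : Prop :=
  (∀ a ∈ w, a = 1 ∨ a = -1) ∧ w.sum = 0 ∧ ∀ k, 0 ≤ (w.take k).sum

/-- Width of a finite set of naturals: the least number of intervals of
consecutive integers whose union equals the set. -/
noncomputable def setWidth (S : Finset ℕ) : ℕ :=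
  sInf {k | ∃ f : Fin k → ℕ × ℕ, (S : Set ℕ) = ⋃ i, Set.Icc (f i).1 (f i).2}

/-- A re-pairing of a word `w` over `{+1, -1}` (positions are 0-based):
a sequence of pairs (ℓᵢ, rᵢ) with w(ℓᵢ) = +1, w(rᵢ) = −1, ℓᵢ < rᵢ, such that
every position of `w` occurs in exactly one pair. -/
structure RePairing (w : List ℤ) where
  pairs : List (ℕ × ℕ)
  perm : (pairs.flatMap fun q => [q.1, q.2]).Perm (List.range w.length)
  lt : ∀ q ∈ pairs, q.1 < q.2
  plus : ∀ q ∈ pairs, w.getD q.1 0 = 1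
  minus : ∀ q ∈ pairs, w.getD q.2 0 = -1

/-- The width of a re-pairing: maximum over times `t` of the width of the set
of positions erased within the first `t` pairs. -/
noncomputable def repWidth {w : List ℤ} (p : RePairing w) : ℕ :=
  (Finset.range (p.pairs.length + 1)).sup
    fun t => setWidth ((p.pairs.take t).flatMap fun q => [q.1, q.2]).toFinset

/-- Width of a word: minimum width over all its re-pairings. -/
noncomputable def dyckWidth (w : List ℤ) : ℕ :=
  sInf {k | ∃ p : RePairing w, repWidth p = k}

/-- Ordered rooted trees. -/
inductive OTree where
  | node : List OTree → OTree

/-- The Dyck prime associated with an ordered rooted tree. -/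
def treeWord : OTree → List ℤ
  | .node ts => 1 :: (((ts.attach.map fun x => treeWord x.1).flatten) ++ [-1])
decreasing_by
  have := List.sizeOf_lt_of_mem x.2
  simp only [OTree.node.sizeOf_spec]
  omega

/-- A tree is binary if every node has at most two children. -/
inductive Binary : OTree → Prop
  | node (ts : List OTree) (h : ts.length ≤ 2) (hc : ∀ t ∈ ts, Binary t) :
      Binary (.node ts)

/-- Nodes of a tree, identified by the list of child indices from the root. -/
inductive TreeNode : OTree → List ℕ → Prop
  | nil (t : OTree) : TreeNode t []
  | cons (ts : List OTree) (i : ℕ) (h : i < ts.length) (p : List ℕ)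
      (hp : TreeNode ts[i] p) : TreeNode (.node ts) (i :: p)

/-- Moves of the black-and-white pebble game on a rooted tree; a configuration
is a pair (black pebbles, white pebbles). The children of a node `v` are the
nodes of the form `v ++ [i]`. -/
inductive PMove (t : OTree) :
    Finset (List ℕ) × Finset (List ℕ) → Finset (List ℕ) × Finset (List ℕ) → Prop
  | placeBlack (B W : Finset (List ℕ)) (v : List ℕ) (hv : TreeNode t v)
      (h : ∀ i : ℕ, TreeNode t (v ++ [i]) → (v ++ [i]) ∈ B ∪ W) :
      PMove t (B, W) (insert v B, W)
  | removeBlack (B W : Finset (List ℕ)) (v : List ℕ) (hv : v ∈ B) :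
      PMove t (B, W) (B.erase v, W)
  | placeWhite (B W : Finset (List ℕ)) (v : List ℕ) (hv : TreeNode t v) :
      PMove t (B, W) (B, insert v W)
  | removeWhite (B W : Finset (List ℕ)) (v : List ℕ) (hv : v ∈ W)
      (h : ∀ i : ℕ, TreeNode t (v ++ [i]) → (v ++ [i]) ∈ B ∪ W) :
      PMove t (B, W) (B, W.erase v)

/-- Minimum number of pebbles sufficient for a successful strategy in the
black-and-white pebble game on `t`: starting from the empty configuration,
reach a configuration where the root carries a (black) pebble and no white
pebbles remain. -/
noncomputable def bw (t : OTree) : ℕ :=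
  sInf {k | ∃ cs : List (Finset (List ℕ) × Finset (List ℕ)),
    cs.Chain' (PMove t) ∧ cs.head? = some (∅, ∅) ∧
    (∃ last, cs.getLast? = some last ∧ [] ∈ last.1 ∧ last.2 = ∅) ∧
    ∀ c ∈ cs, c.1.card + c.2.card ≤ k}

/-- A Dyck prime: `+ σ₁ −` with `σ₁` a Dyck word. -/
def IsDyckPrime (w : List ℤ) : Prop :=
  IsDyck w ∧ w ≠ [] ∧ ∀ k, 0 < k → k < w.length → 0 < (w.take k).sum

/-- Positions `i < j` form a matched pair of `w` (0-based): the factor of `w`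
from `i` to `j` is a Dyck prime. -/
def Matched (w : List ℤ) (i j : ℕ) : Prop :=
  i < j ∧ j < w.length ∧ IsDyckPrime ((w.drop i).take (j + 1 - i))

/-- Minimum width of a *simple* re-pairing of `w`: one all of whose pairs are
matched pairs of `w`. -/
noncomputable def simpleWidth (w : List ℤ) : ℕ :=
  sInf {k | ∃ p : RePairing w,
    (∀ q ∈ p.pairs, Matched w q.1 q.2) ∧ repWidth p = k}

mutual

/-- The Euler tour of a tree rooted at the path `p`: each node is listed when it is entered (`true`)
and when it is left (`false`). -/
def OTree.tour (p : List ℕ) : OTree → List (List ℕ × Bool)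
  | .node ts => (p, true) :: (OTree.forestTour p 0 ts ++ [(p, false)])

/-- The concatenated Euler tours of a list of trees rooted at `p ++ [i]`, `p ++ [i + 1]`, …. -/
def OTree.forestTour (p : List ℕ) (i : ℕ) : List OTree → List (List ℕ × Bool)
  | [] => []
  | t :: ts => t.tour (p ++ [i]) ++ OTree.forestTour p (i + 1) ts

end

theorem OTree.forest_induction {P : OTree → Prop} {Q : List OTree → Prop}
    (node : ∀ ts, Q ts → P (.node ts)) (nil : Q [])
    (cons : ∀ t ts, P t → Q ts → Q (t :: ts)) (t : OTree) : P t :=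
  OTree.rec (motive_1 := P) (motive_2 := Q) node nil cons t

theorem OTree.tour_node (p : List ℕ) (ts : List OTree) :
    (OTree.node ts).tour p = (p, true) :: (OTree.forestTour p 0 ts ++ [(p, false)]) := by
  rw [OTree.tour]

/-- The letter of a Dyck word written when entering (`true`) or leaving (`false`) a node. -/
def tourLetter (e : List ℕ × Bool) : ℤ := if e.2 then 1 else -1

theorem treeWord_node (ts : List OTree) :
    treeWord (.node ts) = 1 :: ((ts.map treeWord).flatten ++ [-1]) := by
  rw [treeWord]
  simp

theorem OTree.map_tourLetter_tour (t : OTree) (p : List ℕ) :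
    (t.tour p).map tourLetter = treeWord t := by
  induction t using OTree.forest_induction
    (Q := fun ts => ∀ p i, (OTree.forestTour p i ts).map tourLetter = (ts.map treeWord).flatten)
    generalizing p with
  | node ts ih => simp [OTree.tour_node, treeWord_node, ih, tourLetter]
  | nil => rfl
  | cons t ts iht ihts p i => simp [OTree.forestTour, iht, ihts]

theorem OTree.mem_tour (t : OTree) (p q : List ℕ) (b : Bool) :
    (q, b) ∈ t.tour p ↔ ∃ r, q = p ++ r ∧ TreeNode t r := by
  induction t using OTree.forest_induction
    (Q := fun ts => ∀ p i, (q, b) ∈ OTree.forestTour p i ts ↔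
      ∃ (j : ℕ) (h : j < ts.length) (r : List ℕ), q = p ++ (i + j) :: r ∧ TreeNode ts[j] r)
    generalizing p with
  | node ts ih =>
    have h1 : (q, b) ∈ (OTree.node ts).tour p ↔ q = p ∨ (q, b) ∈ OTree.forestTour p 0 ts := by
      rw [OTree.tour_node]
      cases b <;> simp [or_comm]
    rw [h1, ih]
    constructor
    · rintro (rfl | ⟨j, h, r, rfl, hr⟩)
      · exact ⟨[], by simp, .nil _⟩
      · exact ⟨j :: r, by simp, .cons _ _ h _ hr⟩
    · rintro ⟨r, rfl, hr⟩
      cases hr with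
      | nil => simp
      | cons _ j h r hr => exact .inr ⟨j, h, r, by simp, hr⟩
  | nil => simp [OTree.forestTour]
  | cons t ts iht ihts p i =>
    rw [OTree.forestTour, List.mem_append, iht, ihts]
    constructor
    · rintro (⟨r, rfl, hr⟩ | ⟨j, h, r, rfl, hr⟩)
      · exact ⟨0, by simp, r, by simp, hr⟩
      · exact ⟨j + 1, by simpa using h, r, by simp; omega, hr⟩
    · rintro ⟨j, h, r, rfl, hr⟩
      cases j with
      | zero => exact .inl ⟨r, by simp, hr⟩
      | succ j => exact .inr ⟨j, by simpa using h, r, by simp; omega, hr⟩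

theorem OTree.mem_forestTour {ts : List OTree} {p q : List ℕ} {b : Bool} {i : ℕ}
    (h : (q, b) ∈ OTree.forestTour p i ts) : ∃ j r, i ≤ j ∧ q = p ++ j :: r := by
  induction ts generalizing i with
  | nil => simp [OTree.forestTour] at h
  | cons t ts ih =>
    rw [OTree.forestTour, List.mem_append, OTree.mem_tour] at h
    rcases h with ⟨r, rfl, -⟩ | h
    · exact ⟨i, r, le_rfl, by simp⟩
    · obtain ⟨j, r, hj, rfl⟩ := ih h
      exact ⟨j, r, by omega, rfl⟩

theorem OTree.nodup_tour (t : OTree) (p : List ℕ) : (t.tour p).Nodup := by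
  induction t using OTree.forest_induction
    (Q := fun ts => ∀ p i, (OTree.forestTour p i ts).Nodup) generalizing p with
  | node ts ih =>
    have key : ∀ b, (p, b) ∉ OTree.forestTour p 0 ts := by
      intro b h
      obtain ⟨j, r, -, h⟩ := OTree.mem_forestTour h
      simp at h
    rw [OTree.tour_node, List.nodup_cons, List.nodup_append]
    refine ⟨by simp [key], ih p 0, by simp, ?_⟩
    rintro a ha b hb rfl
    simp only [List.mem_singleton] at hb
    exact key _ (hb ▸ ha)
  | nil => simp [OTree.forestTour]
  | cons t ts iht ihts p i =>
    rw [OTree.forestTour, List.nodup_append]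
    refine ⟨iht _, ihts _ _, ?_⟩
    rintro ⟨a, b⟩ ha _ hb rfl
    obtain ⟨r, rfl, -⟩ := (OTree.mem_tour _ _ _ _).1 ha
    obtain ⟨j, r', hj, h⟩ := OTree.mem_forestTour hb
    simp only [List.append_assoc, List.append_cancel_left_eq, List.cons_append, List.nil_append,
      List.cons.injEq] at h
    omega

theorem OTree.tour_eq (t : OTree) (p : List ℕ) :
    ∃ m, t.tour p = (p, true) :: (m ++ [(p, false)]) := by
  cases t with
  | node ts => exact ⟨_, OTree.tour_node p ts⟩

/-- The possible relations between consecutive entries of an Euler tour. -/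
inductive TourStep : List ℕ × Bool → List ℕ × Bool → Prop
  | leaf (u : List ℕ) : TourStep (u, true) (u, false)
  | down (u : List ℕ) (i : ℕ) (b : Bool) : TourStep (u, b) (u ++ [i], true)
  | up (u : List ℕ) (i : ℕ) (b : Bool) : TourStep (u ++ [i], false) (u, b)
  | across (u : List ℕ) (i j : ℕ) : TourStep (u ++ [i], false) (u ++ [j], true)

theorem OTree.isChain_tour (t : OTree) (p : List ℕ) : (t.tour p).IsChain TourStep := by
  induction t using OTree.forest_induction
    (Q := fun ts => ∀ p i, (OTree.forestTour p i ts).IsChain TourStep ∧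
      (∀ e ∈ (OTree.forestTour p i ts).head?, e = (p ++ [i], true)) ∧
      ∀ e ∈ (OTree.forestTour p i ts).getLast?, ∃ j, e = (p ++ [j], false)) generalizing p with
  | node ts ih =>
    obtain ⟨h1, h2, h3⟩ := ih p 0
    rw [OTree.tour_node, List.isChain_cons, List.isChain_append]
    refine ⟨?_, h1, by simp, ?_⟩
    · intro e he
      rw [List.head?_append] at he
      cases hF : (OTree.forestTour p 0 ts).head? with
      | none =>
        simp only [hF] at he
        simp at he
        rw [← he]
        exact .leaf p
      | some x =>
        simp only [hF] at he
        simp at he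
        rw [← he, h2 x hF]
        exact .down _ _ _
    · intro x hx y hy
      obtain ⟨j, rfl⟩ := h3 x hx
      simp at hy
      rw [← hy]
      exact .up _ _ _
  | nil => simp [OTree.forestTour]
  | cons t ts iht ihts p i =>
    obtain ⟨h1, h2, h3⟩ := ihts p (i + 1)
    obtain ⟨m, hm⟩ := t.tour_eq (p ++ [i])
    have hlast : (t.tour (p ++ [i])).getLast? = some (p ++ [i], false) := by
      rw [hm, ← List.cons_append, List.getLast?_concat]
    rw [OTree.forestTour]
    refine ⟨?_, ?_, ?_⟩
    · rw [List.isChain_append]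
      refine ⟨iht _, h1, ?_⟩
      intro x hx y hy
      rw [hlast] at hx
      simp at hx
      rw [← hx, h2 y hy]
      exact .across _ _ _
    · intro e he
      rw [hm] at he
      simp at he
      exact he.symm
    · intro e he
      rw [List.getLast?_append] at he
      cases hF : (OTree.forestTour p (i + 1) ts).getLast? with
      | none =>
        simp only [hF, hlast] at he
        simp at he
        exact ⟨i, he.symm⟩
      | some x =>
        simp only [hF] at he
        simp at he
        exact he ▸ h3 x hF

theorem OTree.tour_isInfix_forestTour {ts : List OTree} {p : List ℕ} {i j : ℕ}
    (h : j < ts.length) : ts[j].tour (p ++ [i + j]) <:+: OTree.forestTour p i ts := by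
  induction ts generalizing i j with
  | nil => simp at h
  | cons t ts ih =>
    rw [OTree.forestTour]
    cases j with
    | zero => exact (List.prefix_append _ _).isInfix
    | succ j =>
      have h' : j < ts.length := by simpa using h
      refine List.IsInfix.trans ?_ (List.suffix_append _ _).isInfix
      have := ih (i := i + 1) h'
      rwa [show i + 1 + j = i + (j + 1) by omega] at this

theorem TreeNode.exists_subtree {t : OTree} {v : List ℕ} (h : TreeNode t v) :
    ∃ ts, (∀ p, (OTree.node ts).tour (p ++ v) <:+: t.tour p) ∧
      (∀ q, TreeNode t (v ++ q) ↔ TreeNode (.node ts) q) ∧ (Binary t → ts.length ≤ 2) := by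
  induction h with
  | nil t =>
    obtain ⟨ts⟩ := t
    refine ⟨ts, fun p => by simp, fun q => by simp, ?_⟩
    rintro ⟨_, h, -⟩
    exact h
  | cons ts i h p hp ih =>
    obtain ⟨ts', h1, h2, h3⟩ := ih
    refine ⟨ts', fun q => ?_, fun q => ?_, ?_⟩
    · rw [OTree.tour_node q ts]
      refine List.IsInfix.trans ?_ (List.suffix_cons _ _).isInfix
      refine List.IsInfix.trans ?_ (List.prefix_append _ _).isInfix
      have := OTree.tour_isInfix_forestTour (p := q) (i := 0) h
      refine List.IsInfix.trans ?_ this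
      simpa using h1 (q ++ [i])
    · rw [← h2]
      constructor
      · rintro (_ | ⟨_, _, _, _, h⟩)
        exact h
      · exact fun h' => .cons _ _ h _ h'
    · rintro ⟨_, -, hc⟩
      exact h3 (hc _ (List.getElem_mem h))

theorem TreeNode.of_append {t : OTree} {v q : List ℕ} (h : TreeNode t (v ++ q)) :
    TreeNode t v := by
  induction v generalizing t with
  | nil => exact .nil t
  | cons i v ih =>
    rcases h with _ | ⟨ts, _, hi, _, hp⟩
    exact .cons ts i hi v (ih hp)

theorem TreeNode.exists_tour_factor {t : OTree} {v : List ℕ} {i : ℕ} (ht : Binary t)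
    (h : TreeNode t (v ++ [i])) :
    [(v, true), (v ++ [i], true)] <:+: t.tour [] ∨
      [(v ++ [i], false), (v, false)] <:+: t.tour [] := by
  obtain ⟨ts, h1, h2, h3⟩ := h.of_append.exists_subtree
  have hb := h3 ht
  have hi : i < ts.length := by
    rcases (h2 [i]).1 h with _ | ⟨_, _, hi, _, hp⟩
    exact hi
  have h1 := h1 []
  rw [List.nil_append, OTree.tour_node] at h1
  match ts, i, hb, hi with
  | [], _, _, hi => simp at hi
  | [_], i + 1, _, hi => simp at hi
  | [_, _], i + 2, _, hi => simp at hi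
  | _ :: _ :: _ :: _, _, hb, _ => simp at hb
  | a :: l, 0, _, _ =>
    left
    refine List.IsInfix.trans ?_ h1
    obtain ⟨m, hm⟩ := a.tour_eq (v ++ [0])
    refine List.IsPrefix.isInfix ⟨m ++ [(v ++ [0], false)] ++ OTree.forestTour v 1 l ++
      [(v, false)], ?_⟩
    simp [OTree.forestTour, hm]
  | [a, b], 1, _, _ =>
    right
    refine List.IsInfix.trans ?_ h1
    obtain ⟨m, hm⟩ := b.tour_eq (v ++ [1])
    refine List.IsSuffix.isInfix ⟨(v, true) :: (a.tour (v ++ [0]) ++ (v ++ [1], true) :: m), ?_⟩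
    simp [OTree.forestTour, hm]

theorem IsDyck.append {a b : List ℤ} (ha : IsDyck a) (hb : IsDyck b) : IsDyck (a ++ b) := by
  obtain ⟨a1, a2, a3⟩ := ha
  obtain ⟨b1, b2, b3⟩ := hb
  refine ⟨?_, by simp [a2, b2], fun k => ?_⟩
  · intro x hx
    exact (List.mem_append.1 hx).elim (a1 x) (b1 x)
  · rw [List.take_append, List.sum_append]
    exact add_nonneg (a3 _) (b3 _)

theorem IsDyck.isDyckPrime {a : List ℤ} (ha : IsDyck a) : IsDyckPrime (1 :: (a ++ [-1])) := by
  obtain ⟨a1, a2, a3⟩ := ha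
  have key : ∀ k, k ≤ a.length → 0 < ((1 :: (a ++ [-1])).take (k + 1)).sum := by
    intro k hk
    have := a3 k
    rw [List.take_succ_cons, List.take_append, List.sum_cons, List.sum_append]
    simp [Nat.sub_eq_zero_of_le hk]
    omega
  refine ⟨⟨?_, by simp [a2], fun k => ?_⟩, by simp, fun k hk hk' => ?_⟩
  · intro x hx
    simp only [List.mem_cons, List.mem_append, List.not_mem_nil, or_false] at hx
    rcases hx with rfl | hx | rfl
    · simp
    · exact a1 x hx
    · simp
  · rcases k with _ | k
    · simp
    · rcases le_or_gt k a.length with h | h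
      · exact (key k h).le
      · rw [List.take_of_length_le (by simp; omega)]
        simp [a2]
  · obtain ⟨k, rfl⟩ := Nat.exists_eq_add_of_le' hk
    exact key k (by simp at hk'; omega)

theorem isDyckPrime_treeWord (t : OTree) : IsDyckPrime (treeWord t) := by
  induction t using OTree.forest_induction
    (Q := fun ts => IsDyck (ts.map treeWord).flatten) with
  | node ts ih => rw [treeWord_node]; exact ih.isDyckPrime
  | nil => simp [IsDyck]
  | cons t ts iht ihts => simpa using iht.1.append ihts

theorem Matched.right_unique {w : List ℤ} {i j k : ℕ} (hj : Matched w i j) (hk : Matched w i k) :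
    j = k := by
  have key : ∀ {j k}, Matched w i j → Matched w i k → ¬ j < k := by
    intro j k hj hk h
    have h1 := hk.2.2.2.2 (j + 1 - i) (by have := hj.1; omega)
      (by have := hj.1; have := hk.2.1; simp; omega)
    rw [List.take_take, min_eq_left (by omega), hj.2.2.1.2.1] at h1
    exact lt_irrefl _ h1
  have := key hj hk
  have := key hk hj
  omega

theorem List.Nodup.idxOf_of_eq_append {α : Type*} [BEq α] [LawfulBEq α] {l a b : List α} {x : α}
    (hl : l.Nodup) (h : l = a ++ x :: b) : l.idxOf x = a.length := by
  subst h
  have : x ∉ a := fun hx => (List.nodup_append.1 hl).2.2 x hx x (by simp) rfl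
  simp [List.idxOf_append, this]

theorem TreeNode.matched {t : OTree} {v : List ℕ} (h : TreeNode t v) :
    Matched (treeWord t) ((t.tour []).idxOf (v, true)) ((t.tour []).idxOf (v, false)) := by
  obtain ⟨ts, h1, -, -⟩ := h.exists_subtree
  obtain ⟨a, b, hab⟩ := h1 []
  rw [List.nil_append] at hab
  obtain ⟨m, hm⟩ := (OTree.node ts).tour_eq v
  have hE := t.nodup_tour []
  have e1 : (t.tour []).idxOf (v, true) = a.length :=
    hE.idxOf_of_eq_append (x := (v, true)) (a := a) (b := m ++ [(v, false)] ++ b)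
      (by rw [← hab, hm]; simp)
  have e2 : (t.tour []).idxOf (v, false) = (a ++ (v, true) :: m).length :=
    hE.idxOf_of_eq_append (x := (v, false)) (a := a ++ (v, true) :: m) (b := b)
      (by rw [← hab, hm]; simp)
  have hw : treeWord t = a.map tourLetter ++ (treeWord (.node ts) ++ b.map tourLetter) := by
    rw [← t.map_tourLetter_tour [], ← (OTree.node ts).map_tourLetter_tour v, ← hab]
    simp
  have hlen : (treeWord (.node ts)).length = m.length + 2 := by
    rw [← (OTree.node ts).map_tourLetter_tour v, hm]
    simp
  rw [e1, e2]
  refine ⟨by simp, ?_, ?_⟩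
  · rw [hw]; simp [hlen]; omega
  · have : ((treeWord t).drop a.length).take ((a ++ (v, true) :: m).length + 1 - a.length) =
        treeWord (.node ts) := by
      rw [hw, List.drop_left' (by simp)]
      exact List.take_left' (by simp [hlen]; omega)
    rw [this]
    exact isDyckPrime_treeWord _

theorem exists_intervals_card_rightEnds (P : Finset ℕ) :
    ∃ f : Fin (P.filter fun x => x + 1 ∉ P).card → ℕ × ℕ,
      (P : Set ℕ) = ⋃ i, Set.Icc (f i).1 (f i).2 := by
  classical
  have hlo : ∀ x ∈ P, ∃ y, Set.Icc y x ⊆ P ∧ ∀ z, Set.Icc z x ⊆ P → y ≤ z := by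
    intro x hx
    have hex : ∃ y, Set.Icc y x ⊆ (P : Set ℕ) := ⟨x, by simpa using hx⟩
    exact ⟨Nat.find hex, Nat.find_spec hex, fun z hz => Nat.find_min' hex hz⟩
  choose! lo hlo1 hlo2 using hlo
  refine ⟨fun i => (lo ((P.filter fun x => x + 1 ∉ P).equivFin.symm i),
    ((P.filter fun x => x + 1 ∉ P).equivFin.symm i)), Set.Subset.antisymm ?_ ?_⟩
  · intro z hz
    have hex : ∃ n, z + n + 1 ∉ P := by
      by_contra! h
      exact Set.infinite_of_injective_forall_mem (f := fun n => z + n + 1)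
        (fun a b hab => by simpa using hab) h P.finite_toSet
    have hmin : ∀ n ≤ Nat.find hex, z + n ∈ P := by
      intro n hn
      cases n with
      | zero => exact hz
      | succ n => exact not_not.1 (Nat.find_min hex (m := n) (by omega))
    have hmem : z + Nat.find hex ∈ P.filter fun x => x + 1 ∉ P :=
      Finset.mem_filter.2 ⟨hmin _ le_rfl, Nat.find_spec hex⟩
    refine Set.mem_iUnion.2 ⟨(P.filter fun x => x + 1 ∉ P).equivFin ⟨_, hmem⟩, ?_⟩
    simp only [Equiv.symm_apply_apply]
    refine ⟨hlo2 _ (hmin _ le_rfl) z ?_, by simp⟩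
    rintro y ⟨hy1, hy2⟩
    obtain ⟨n, rfl⟩ := Nat.exists_eq_add_of_le hy1
    exact hmin n (by omega)
  · refine Set.iUnion_subset fun i => hlo1 _ ?_
    exact (Finset.mem_filter.1 ((P.filter fun x => x + 1 ∉ P).equivFin.symm i).2).1

theorem setWidth_le_card_rightEnds (P : Finset ℕ) :
    setWidth P ≤ (P.filter fun x => x + 1 ∉ P).card :=
  Nat.sInf_le (exists_intervals_card_rightEnds P)

theorem exists_intervals_setWidth (P : Finset ℕ) :
    ∃ f : Fin (setWidth P) → ℕ × ℕ, (P : Set ℕ) = ⋃ i, Set.Icc (f i).1 (f i).2 :=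
  Nat.sInf_mem (s := {k | ∃ f : Fin k → ℕ × ℕ, (P : Set ℕ) = ⋃ i, Set.Icc (f i).1 (f i).2})
    ⟨_, exists_intervals_card_rightEnds P⟩

theorem exists_boundary_card_le (P : Finset ℕ) :
    ∃ Q : Finset ℕ, Q.card ≤ 2 * setWidth P ∧ ∀ x, ¬ (x ∈ P ↔ x + 1 ∈ P) → x ∈ Q := by
  classical
  obtain ⟨f, hf⟩ := exists_intervals_setWidth P
  have hP : ∀ x, x ∈ P ↔ ∃ i, (f i).1 ≤ x ∧ x ≤ (f i).2 := by
    intro x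
    rw [← Finset.mem_coe, hf]
    simp
  refine ⟨Finset.univ.image (fun i => (f i).2) ∪ Finset.univ.image (fun i => (f i).1 - 1), ?_, ?_⟩
  · refine (Finset.card_union_le _ _).trans ?_
    have h1 := Finset.card_image_le (s := Finset.univ) (f := fun i => (f i).2)
    have h2 := Finset.card_image_le (s := Finset.univ) (f := fun i => (f i).1 - 1)
    simp only [Finset.card_univ, Fintype.card_fin] at h1 h2
    omega
  · intro x hx
    simp only [Finset.mem_union, Finset.mem_image, Finset.mem_univ, true_and]
    by_cases h : x ∈ P
    · have h' : x + 1 ∉ P := by tauto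
      obtain ⟨i, hi1, hi2⟩ := (hP x).1 h
      refine .inl ⟨i, ?_⟩
      by_contra hne
      exact h' ((hP _).2 ⟨i, by omega, by omega⟩)
    · have h' : x + 1 ∈ P := by tauto
      obtain ⟨i, hi1, hi2⟩ := (hP _).1 h'
      refine .inr ⟨i, ?_⟩
      by_contra hne
      exact h ((hP _).2 ⟨i, by omega, by omega⟩)

theorem setWidth_pos {P : Finset ℕ} (hP : P.Nonempty) : 0 < setWidth P := by
  obtain ⟨f, hf⟩ := exists_intervals_setWidth P
  obtain ⟨x, hx⟩ := hP
  rw [← Finset.mem_coe, hf] at hx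
  obtain ⟨i, -⟩ := Set.mem_iUnion.1 hx
  exact i.pos

/-- The nodes of a tree, as a finite set. -/
def OTree.nodes (t : OTree) : Finset (List ℕ) := ((t.tour []).map Prod.fst).toFinset

theorem OTree.mem_nodes {t : OTree} {v : List ℕ} : v ∈ t.nodes ↔ TreeNode t v := by
  simp [OTree.nodes, OTree.mem_tour]

theorem OTree.mem_tour_nil {t : OTree} {e : List ℕ × Bool} :
    e ∈ t.tour [] ↔ TreeNode t e.1 := by
  obtain ⟨v, b⟩ := e
  simp [OTree.mem_tour]

/-- The nodes other than the root that are separated from their parent by `S`. -/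
def OTree.cut (t : OTree) (S : Finset (List ℕ)) : Finset (List ℕ) :=
  t.nodes.filter fun c => c ≠ [] ∧ ¬ (c ∈ S ↔ c.dropLast ∈ S)

theorem OTree.mem_cut {t : OTree} {S : Finset (List ℕ)} {v : List ℕ} {i : ℕ} :
    v ++ [i] ∈ t.cut S ↔ TreeNode t (v ++ [i]) ∧ ¬ (v ++ [i] ∈ S ↔ v ∈ S) := by
  simp [OTree.cut, OTree.mem_nodes]

/-- The position in the Dyck word at which a node is entered or left. -/
def OTree.pos (t : OTree) (e : List ℕ × Bool) : ℕ := (t.tour []).idxOf e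

theorem OTree.pos_inj {t : OTree} {e e' : List ℕ × Bool} (h : TreeNode t e.1)
    (h' : t.pos e = t.pos e') : e = e' :=
  (List.idxOf_inj (OTree.mem_tour_nil.2 h)).1 h'

theorem OTree.pos_getElem {t : OTree} {x : ℕ} (h : x < (t.tour []).length) :
    t.pos (t.tour [])[x] = x := (t.nodup_tour []).idxOf_getElem x h

/-- The positions of a list of nodes. -/
def OTree.posSet (t : OTree) (l : List (List ℕ)) : Finset ℕ :=
  ((l.map fun v => (t.pos (v, true), t.pos (v, false))).flatMap fun q => [q.1, q.2]).toFinset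

theorem OTree.mem_posSet {t : OTree} {l : List (List ℕ)} {x : ℕ} :
    x ∈ t.posSet l ↔ ∃ e : List ℕ × Bool, e.1 ∈ l ∧ t.pos e = x := by
  simp only [OTree.posSet, List.mem_toFinset, List.mem_flatMap, List.mem_map, List.mem_cons,
    List.not_mem_nil, or_false]
  constructor
  · rintro ⟨_, ⟨v, hv, rfl⟩, rfl | rfl⟩
    · exact ⟨(v, true), hv, rfl⟩
    · exact ⟨(v, false), hv, rfl⟩
  · rintro ⟨⟨v, b⟩, hv, rfl⟩
    refine ⟨_, ⟨v, hv, rfl⟩, ?_⟩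
    cases b <;> simp

theorem OTree.pos_mem_posSet {t : OTree} {l : List (List ℕ)} {e : List ℕ × Bool}
    (h : TreeNode t e.1) : t.pos e ∈ t.posSet l ↔ e.1 ∈ l := by
  rw [OTree.mem_posSet]
  constructor
  · rintro ⟨e', he', h'⟩
    rwa [OTree.pos_inj h h'.symm]
  · exact fun h' => ⟨e, h', rfl⟩

theorem OTree.pos_succ {t : OTree} {e e' : List ℕ × Bool} (h : [e, e'] <:+: t.tour []) :
    t.pos e' = t.pos e + 1 := by
  obtain ⟨a, b, hab⟩ := h
  have h1 : t.pos e = a.length :=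
    (t.nodup_tour []).idxOf_of_eq_append (x := e) (a := a) (b := e' :: b) (by rw [← hab]; simp)
  have h2 : t.pos e' = (a ++ [e]).length :=
    (t.nodup_tour []).idxOf_of_eq_append (x := e') (a := a ++ [e]) (b := b) (by rw [← hab]; simp)
  rw [h1, h2]
  simp

theorem OTree.card_cut_le {t : OTree} (ht : Binary t) (l : List (List ℕ)) :
    (t.cut l.toFinset).card ≤ 4 * setWidth (t.posSet l) := by
  classical
  obtain ⟨Q, hQ, hQ'⟩ := exists_boundary_card_le (t.posSet l)
  have hsub : t.cut l.toFinset ⊆ Q.image (fun x => ((t.tour []).getD (x + 1) ([], true)).1) ∪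
      Q.image (fun x => ((t.tour []).getD x ([], true)).1) := by
    intro c hc
    obtain rfl | ⟨v, i, rfl⟩ := c.eq_nil_or_concat'
    · simp [OTree.cut] at hc
    · obtain ⟨hn, hcut⟩ := OTree.mem_cut.1 hc
      have hv := hn.of_append
      simp only [List.mem_toFinset] at hcut
      have hget : ∀ e : List ℕ × Bool, TreeNode t e.1 →
          (t.tour []).getD (t.pos e) ([], true) = e := by
        intro e he
        have hlt : t.pos e < (t.tour []).length :=
          List.idxOf_lt_length_of_mem (OTree.mem_tour_nil.2 he)
        rw [List.getD_eq_getElem _ _ hlt]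
        exact List.getElem_idxOf hlt
      rcases hn.exists_tour_factor ht with h | h
      · refine Finset.mem_union_left _ (Finset.mem_image.2 ⟨t.pos (v, true), hQ' _ ?_, ?_⟩)
        · rw [← OTree.pos_succ h, OTree.pos_mem_posSet (e := (v, true)) hv,
            OTree.pos_mem_posSet (e := (v ++ [i], true)) hn]
          tauto
        · rw [← OTree.pos_succ h, hget (v ++ [i], true) hn]
      · refine Finset.mem_union_right _ (Finset.mem_image.2 ⟨t.pos (v ++ [i], false), hQ' _ ?_, ?_⟩)
        · rw [← OTree.pos_succ h, OTree.pos_mem_posSet (e := (v, false)) hv,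
            OTree.pos_mem_posSet (e := (v ++ [i], false)) hn]
          tauto
        · rw [hget (v ++ [i], false) hn]
  have h1 := Finset.card_le_card hsub
  have h2 := Finset.card_union_le (Q.image (fun x => ((t.tour []).getD (x + 1) ([], true)).1))
    (Q.image (fun x => ((t.tour []).getD x ([], true)).1))
  have h3 := Finset.card_image_le (s := Q) (f := fun x => ((t.tour []).getD (x + 1) ([], true)).1)
  have h4 := Finset.card_image_le (s := Q) (f := fun x => ((t.tour []).getD x ([], true)).1)
  omega

theorem OTree.setWidth_posSet_le {t : OTree} {l : List (List ℕ)} (hl : ∀ v ∈ l, TreeNode t v) :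
    setWidth (t.posSet l) ≤ 2 * (t.cut l.toFinset).card + 1 := by
  classical
  refine (setWidth_le_card_rightEnds _).trans ?_
  have hsub : (t.posSet l).filter (fun x => x + 1 ∉ t.posSet l) ⊆
      {(t.tour []).length - 1} ∪ ((t.cut l.toFinset).image (fun c => t.pos (c, true) - 1) ∪
        (t.cut l.toFinset).image (fun c => t.pos (c, false))) := by
    intro x hx
    obtain ⟨hx, hx'⟩ := Finset.mem_filter.1 hx
    obtain ⟨e, he, rfl⟩ := OTree.mem_posSet.1 hx
    have hen := hl _ he
    have hlt : t.pos e < (t.tour []).length :=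
      List.idxOf_lt_length_of_mem (OTree.mem_tour_nil.2 hen)
    simp only [Finset.mem_union, Finset.mem_singleton, Finset.mem_image]
    rcases Nat.lt_or_ge (t.pos e + 1) (t.tour []).length with hlt' | hge
    · have hstep := List.isChain_iff_getElem.1 (t.isChain_tour []) (t.pos e) hlt'
      have hgete : (t.tour [])[t.pos e] = e := List.getElem_idxOf hlt
      rw [hgete] at hstep
      have hpos := OTree.pos_getElem hlt'
      have hen' := OTree.mem_tour_nil.1 (List.getElem_mem hlt')
      generalize (t.tour [])[t.pos e + 1] = e' at hstep hpos hen'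
      have he' : e'.1 ∉ l := by
        rwa [← hpos, OTree.pos_mem_posSet hen'] at hx'
      right
      cases hstep with
      | leaf u => exact absurd he he'
      | down u i b =>
        refine .inl ⟨u ++ [i], OTree.mem_cut.2 ⟨hen', ?_⟩, by omega⟩
        simp only [List.mem_toFinset]
        tauto
      | up u i b =>
        refine .inr ⟨u ++ [i], OTree.mem_cut.2 ⟨hen, ?_⟩, rfl⟩
        simp only [List.mem_toFinset]
        tauto
      | across u i j =>
        by_cases hu : u ∈ l
        · refine .inl ⟨u ++ [j], OTree.mem_cut.2 ⟨hen', ?_⟩, by omega⟩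
          simp only [List.mem_toFinset]
          tauto
        · refine .inr ⟨u ++ [i], OTree.mem_cut.2 ⟨hen, ?_⟩, rfl⟩
          simp only [List.mem_toFinset]
          tauto
    · left
      omega
  have h1 := Finset.card_le_card hsub
  have h2 := Finset.card_union_le {(t.tour []).length - 1}
    ((t.cut l.toFinset).image (fun c => t.pos (c, true) - 1) ∪
        (t.cut l.toFinset).image (fun c => t.pos (c, false)))
  have h3 := Finset.card_union_le ((t.cut l.toFinset).image (fun c => t.pos (c, true) - 1))
        ((t.cut l.toFinset).image (fun c => t.pos (c, false)))
  have h4 := Finset.card_image_le (s := t.cut l.toFinset) (f := fun c => t.pos (c, true) - 1)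
  have h5 := Finset.card_image_le (s := t.cut l.toFinset) (f := fun c => t.pos (c, false))
  simp only [Finset.card_singleton] at h2
  omega

theorem OTree.length_treeWord (t : OTree) : (treeWord t).length = (t.tour []).length := by
  rw [← t.map_tourLetter_tour []]
  simp

theorem OTree.treeWord_getD_pos {t : OTree} {e : List ℕ × Bool} (h : TreeNode t e.1) :
    (treeWord t).getD (t.pos e) 0 = tourLetter e := by
  have hlt : t.pos e < (t.tour []).length :=
    List.idxOf_lt_length_of_mem (OTree.mem_tour_nil.2 h)
  rw [List.getD_eq_getElem _ _ (by rwa [t.length_treeWord])]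
  simp only [← t.map_tourLetter_tour [], List.getElem_map]
  congr 1
  exact List.getElem_idxOf hlt

theorem OTree.map_pos_tour (t : OTree) :
    (t.tour []).map t.pos = List.range (t.tour []).length := by
  refine List.ext_getElem (by simp) fun i h1 h2 => ?_
  simpa using OTree.pos_getElem (by simpa using h1)

/-- A listing of the nodes of `t`, each occurring once. -/
def OTree.IsListing (t : OTree) (l : List (List ℕ)) : Prop :=
  l.Nodup ∧ ∀ v, v ∈ l ↔ TreeNode t v

theorem OTree.IsListing.perm {t : OTree} {l : List (List ℕ)} (hl : t.IsListing l) :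
    ((l.map fun v => (t.pos (v, true), t.pos (v, false))).flatMap fun q => [q.1, q.2]).Perm
      (List.range (treeWord t).length) := by
  have h1 : (l.map fun v => (t.pos (v, true), t.pos (v, false))).flatMap (fun q => [q.1, q.2]) =
      (l.flatMap fun v => [(v, true), (v, false)]).map t.pos := by
    simp [List.flatMap_map, List.map_flatMap]
  rw [h1, t.length_treeWord, ← t.map_pos_tour]
  refine List.Perm.map _ ((List.perm_ext_iff_of_nodup ?_ (t.nodup_tour [])).2 ?_)
  · rw [List.nodup_flatMap]
    refine ⟨by simp, hl.1.imp ?_⟩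
    intro a b hab
    simp [Function.onFun, hab.symm]
  · rintro ⟨v, b⟩
    rw [OTree.mem_tour_nil]
    simp only [List.mem_flatMap, ← hl.2]
    constructor
    · rintro ⟨u, hu, h⟩
      simp only [List.mem_cons, List.not_mem_nil, or_false, Prod.mk.injEq] at h
      rcases h with ⟨rfl, -⟩ | ⟨rfl, -⟩ <;> exact hu
    · intro h
      exact ⟨v, h, by cases b <;> simp⟩

/-- The simple re-pairing erasing the nodes of `t` in the order of a listing. -/
def OTree.IsListing.rePairing {t : OTree} {l : List (List ℕ)} (hl : t.IsListing l) :
    RePairing (treeWord t) where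
  pairs := l.map fun v => (t.pos (v, true), t.pos (v, false))
  perm := hl.perm
  lt := by
    simp only [List.mem_map]
    rintro _ ⟨v, hv, rfl⟩
    exact ((hl.2 v).1 hv).matched.1
  plus := by
    simp only [List.mem_map]
    rintro _ ⟨v, hv, rfl⟩
    rw [OTree.treeWord_getD_pos ((hl.2 v).1 hv)]
    simp [tourLetter]
  minus := by
    simp only [List.mem_map]
    rintro _ ⟨v, hv, rfl⟩
    rw [OTree.treeWord_getD_pos ((hl.2 v).1 hv)]
    simp [tourLetter]

theorem OTree.IsListing.simpleWidth_le {t : OTree} {l : List (List ℕ)} (hl : t.IsListing l) {k : ℕ}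
    (hk : ∀ n, (t.cut (l.take n).toFinset).card ≤ k) : simpleWidth (treeWord t) ≤ 2 * k + 1 := by
  have hmem : repWidth hl.rePairing ∈ {k | ∃ p : RePairing (treeWord t),
      (∀ q ∈ p.pairs, Matched (treeWord t) q.1 q.2) ∧ repWidth p = k} := ⟨hl.rePairing, ?_, rfl⟩
  · refine (Nat.sInf_le hmem).trans (Finset.sup_le fun n _ => ?_)
    have h1 : setWidth (t.posSet (l.take n)) ≤ 2 * (t.cut (l.take n).toFinset).card + 1 :=
      OTree.setWidth_posSet_le fun v hv => (hl.2 v).1 (List.mem_of_mem_take hv)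
    rw [OTree.posSet, List.map_take] at h1
    exact h1.trans (by have := hk n; omega)
  · simp only [OTree.IsListing.rePairing, List.mem_map]
    rintro _ ⟨v, hv, rfl⟩
    exact ((hl.2 v).1 hv).matched

theorem OTree.isListing_toList_nodes (t : OTree) : t.IsListing t.nodes.toList :=
  ⟨Finset.nodup_toList _, fun v => by rw [Finset.mem_toList, OTree.mem_nodes]⟩

theorem RePairing.setWidth_take_le_repWidth {w : List ℤ} (p : RePairing w) {n : ℕ}
    (hn : n ≤ p.pairs.length) :
    setWidth ((p.pairs.take n).flatMap fun q => [q.1, q.2]).toFinset ≤ repWidth p := by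
  unfold repWidth
  refine Finset.le_sup (f := fun n =>
    setWidth ((p.pairs.take n).flatMap fun q => [q.1, q.2]).toFinset) (Finset.mem_range.2 ?_)
  exact Nat.lt_succ_of_le hn

theorem OTree.exists_isListing_card_cut_le {t : OTree} (ht : Binary t) :
    0 < simpleWidth (treeWord t) ∧ ∃ l, t.IsListing l ∧
      ∀ n, (t.cut (l.take n).toFinset).card ≤ 4 * simpleWidth (treeWord t) := by
  obtain ⟨p, hp, hk⟩ := Nat.sInf_mem (s := {k | ∃ p : RePairing (treeWord t),
    (∀ q ∈ p.pairs, Matched (treeWord t) q.1 q.2) ∧ repWidth p = k})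
    ⟨_, t.isListing_toList_nodes.rePairing, by
      simp only [OTree.IsListing.rePairing, List.mem_map]
      rintro _ ⟨v, hv, rfl⟩
      exact ((t.isListing_toList_nodes.2 v).1 hv).matched, rfl⟩
  change repWidth p = simpleWidth (treeWord t) at hk
  have hex : ∀ q ∈ p.pairs, ∃ v, TreeNode t v ∧ q = (t.pos (v, true), t.pos (v, false)) := by
    intro q hq
    have hm := hp q hq
    have hlt : q.1 < (t.tour []).length := by
      rw [← t.length_treeWord]
      exact hm.1.trans hm.2.1
    have hpos := OTree.pos_getElem hlt
    have hn := OTree.mem_tour_nil.1 (List.getElem_mem hlt)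
    have hplus := p.plus q hq
    generalize (t.tour [])[q.1] = e at hpos hn
    rw [← hpos, OTree.treeWord_getD_pos hn] at hplus
    obtain ⟨v, b⟩ := e
    cases b with
    | false => simp [tourLetter] at hplus
    | true =>
      have h2 := TreeNode.matched hn
      change Matched _ (t.pos (v, true)) (t.pos (v, false)) at h2
      rw [hpos] at h2
      exact ⟨v, hn, Prod.ext hpos.symm (hm.right_unique h2)⟩
  choose! g hg1 hg2 using hex
  have hpairs : (p.pairs.map g).map (fun v => (t.pos (v, true), t.pos (v, false))) = p.pairs := by
    rw [List.map_map]
    conv_rhs => rw [← List.map_id p.pairs]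
    exact List.map_congr_left fun q hq => (hg2 q hq).symm
  have hmem : ∀ v ∈ p.pairs.map g, TreeNode t v := by
    intro v hv
    obtain ⟨q, hq, rfl⟩ := List.mem_map.1 hv
    exact hg1 q hq
  have hall : ∀ v, TreeNode t v → v ∈ p.pairs.map g := by
    intro v hv
    have hv' : TreeNode t ((v, true) : List ℕ × Bool).1 := hv
    rw [← OTree.pos_mem_posSet hv', OTree.posSet, hpairs, List.mem_toFinset, p.perm.mem_iff,
      List.mem_range, t.length_treeWord]
    exact List.idxOf_lt_length_of_mem (OTree.mem_tour_nil.2 hv)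
  have hnodup : (p.pairs.map g).Nodup := by
    have h1 : p.pairs.Nodup := by
      have h2 := p.perm.nodup_iff.2 List.nodup_range
      rw [List.nodup_flatMap] at h2
      refine h2.2.imp ?_
      rintro a _ hab rfl
      simp [Function.onFun] at hab
    refine List.Nodup.map_on ?_ h1
    intro x hx y hy hxy
    rw [hg2 x hx, hg2 y hy, hxy]
  have hwidth : ∀ n, setWidth (t.posSet ((p.pairs.map g).take n)) ≤ simpleWidth (treeWord t) := by
    intro n
    rw [OTree.posSet, List.map_take, hpairs, ← hk]
    rcases le_or_gt n p.pairs.length with h | h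
    · exact p.setWidth_take_le_repWidth h
    · have h1 := p.setWidth_take_le_repWidth le_rfl
      rw [List.take_length] at h1
      rwa [List.take_of_length_le h.le]
  refine ⟨?_, p.pairs.map g, ⟨hnodup, fun v => ⟨hmem v, hall v⟩⟩, fun n => ?_⟩
  · refine lt_of_lt_of_le (setWidth_pos ⟨t.pos ([], true), ?_⟩) (hwidth (p.pairs.map g).length)
    rw [List.take_length]
    exact (OTree.pos_mem_posSet (e := ([], true)) (.nil t)).2 (hall _ (.nil t))
  · exact (OTree.card_cut_le ht _).trans (Nat.mul_le_mul_left 4 (hwidth n))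

/-- The configuration `c` can be reached from the empty one using at most `k` pebbles. -/
def PebbleReach (t : OTree) (k : ℕ) (c : Finset (List ℕ) × Finset (List ℕ)) : Prop :=
  ∃ cs : List (Finset (List ℕ) × Finset (List ℕ)), cs.IsChain (PMove t) ∧
    cs.head? = some (∅, ∅) ∧ cs.getLast? = some c ∧ ∀ d ∈ cs, d.1.card + d.2.card ≤ k

theorem PebbleReach.empty (t : OTree) (k : ℕ) : PebbleReach t k (∅, ∅) :=
  ⟨[(∅, ∅)], by simp, rfl, rfl, by simp⟩

theorem PebbleReach.step {t : OTree} {k : ℕ} {c d : Finset (List ℕ) × Finset (List ℕ)}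
    (h : PebbleReach t k c) (hm : PMove t c d) (hd : d.1.card + d.2.card ≤ k) :
    PebbleReach t k d := by
  obtain ⟨cs, h1, h2, h3, h4⟩ := h
  refine ⟨cs ++ [d], ?_, ?_, by simp, ?_⟩
  · rw [List.isChain_append]
    refine ⟨h1, by simp, ?_⟩
    intro x hx y hy
    rw [h3] at hx
    simp only [Option.mem_def, Option.some.injEq, List.head?_cons] at hx hy
    rw [← hx, ← hy]
    exact hm
  · rw [List.head?_append, h2]
    rfl
  · intro e he
    rcases List.mem_append.1 he with he | he
    · exact h4 e he
    · rw [List.mem_singleton.1 he]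
      exact hd

theorem PebbleReach.placeWhites {t : OTree} {k : ℕ} {B W : Finset (List ℕ)}
    (h : PebbleReach t k (B, W)) (U : Finset (List ℕ)) (hU : ∀ v ∈ U, TreeNode t v)
    (hk : B.card + (W ∪ U).card ≤ k) : PebbleReach t k (B, W ∪ U) := by
  induction U using Finset.induction_on with
  | empty => simpa using h
  | insert v U hv ih =>
    have hle : (W ∪ U).card ≤ (W ∪ insert v U).card :=
      Finset.card_le_card (Finset.union_subset_union_right (Finset.subset_insert _ _))
    have h1 := ih (fun u hu => hU u (Finset.mem_insert_of_mem hu)) (by omega)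
    have h2 := PMove.placeWhite (t := t) B (W ∪ U) v (hU v (Finset.mem_insert_self _ _))
    rw [← Finset.union_insert] at h2
    exact h1.step h2 hk

theorem PebbleReach.removeBlacks {t : OTree} {k : ℕ} {B W B' : Finset (List ℕ)}
    (h : PebbleReach t k (B, W)) (hB : B' ⊆ B) (hk : B.card + W.card ≤ k) :
    PebbleReach t k (B', W) := by
  have key : ∀ U ⊆ B, PebbleReach t k (B \ U, W) := by
    intro U
    induction U using Finset.induction_on with
    | empty => intro _; simpa using h
    | insert v U hv ih =>
      intro hU
      have h1 := ih ((Finset.subset_insert _ _).trans hU)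
      have h2 := PMove.removeBlack (t := t) (B \ U) W v
        (Finset.mem_sdiff.2 ⟨hU (Finset.mem_insert_self _ _), hv⟩)
      rw [← Finset.sdiff_insert] at h2
      refine h1.step h2 ?_
      have : (B \ insert v U).card ≤ B.card := Finset.card_le_card Finset.sdiff_subset
      simp only
      omega
  have := key (B \ B') Finset.sdiff_subset
  rwa [Finset.sdiff_sdiff_eq_self hB] at this

/-- The nodes of `S` whose parent is not in `S`. -/
def blackFrontier (S : Finset (List ℕ)) : Finset (List ℕ) :=
  S.filter fun v => v = [] ∨ v.dropLast ∉ S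

/-- The nodes outside `S` whose parent is in `S`. -/
def OTree.whiteFrontier (t : OTree) (S : Finset (List ℕ)) : Finset (List ℕ) :=
  t.nodes.filter fun v => v ≠ [] ∧ v ∉ S ∧ v.dropLast ∈ S

theorem OTree.card_blackFrontier_le {t : OTree} {S : Finset (List ℕ)}
    (hS : ∀ v ∈ S, TreeNode t v) : (blackFrontier S).card ≤ (t.cut S).card + 1 := by
  have : blackFrontier S ⊆ insert [] (t.cut S) := by
    intro v hv
    simp only [blackFrontier, Finset.mem_filter] at hv
    simp only [OTree.cut, Finset.mem_insert, Finset.mem_filter, OTree.mem_nodes]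
    have := hS v hv.1
    tauto
  exact (Finset.card_le_card this).trans (Finset.card_insert_le _ _)

theorem OTree.card_whiteFrontier_le (t : OTree) (S : Finset (List ℕ)) :
    (t.whiteFrontier S).card ≤ (t.cut S).card := by
  refine Finset.card_le_card fun v hv => ?_
  simp only [OTree.whiteFrontier, OTree.cut, Finset.mem_filter] at hv ⊢
  tauto

theorem PebbleReach.advance {t : OTree} {k : ℕ} {S : Finset (List ℕ)} {v : List ℕ}
    (hS : ∀ u ∈ S, TreeNode t u) (hv : TreeNode t v) (hvS : v ∉ S)
    (hc : (t.cut S).card ≤ k) (hc' : (t.cut (insert v S)).card ≤ k)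
    (h : PebbleReach t (3 * k + 2) (blackFrontier S, t.whiteFrontier S)) :
    PebbleReach t (3 * k + 2) (blackFrontier (insert v S), t.whiteFrontier (insert v S)) := by
  have hS' : ∀ u ∈ insert v S, TreeNode t u := by
    intro u hu
    rcases Finset.mem_insert.1 hu with rfl | hu
    · exact hv
    · exact hS u hu
  have b1 := OTree.card_blackFrontier_le hS
  have b2 := OTree.card_blackFrontier_le hS'
  have w1 := t.card_whiteFrontier_le S
  have w2 := t.card_whiteFrontier_le (insert v S)
  have w3 := Finset.card_union_le (t.whiteFrontier S) (t.whiteFrontier (insert v S))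
  have h1 := h.placeWhites (t.whiteFrontier (insert v S))
    (fun u hu => OTree.mem_nodes.1 (Finset.mem_filter.1 hu).1) (by omega)
  have hchild : ∀ i : ℕ, TreeNode t (v ++ [i]) → v ++ [i] ∈
      blackFrontier S ∪ (t.whiteFrontier S ∪ t.whiteFrontier (insert v S)) := by
    intro i hi
    have hne : v ++ [i] ≠ v := by simp
    simp only [blackFrontier, OTree.whiteFrontier, Finset.mem_union, Finset.mem_filter,
      OTree.mem_nodes, Finset.mem_insert, List.dropLast_concat]
    simp only [ne_eq, List.append_eq_nil_iff, List.cons_ne_self, and_false, not_false_eq_true,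
      false_or, true_and, hi, hne, hvS, true_or, and_true]
    tauto
  by_cases hroot : v = [] ∨ v.dropLast ∉ S
  · have hW : t.whiteFrontier S ∪ t.whiteFrontier (insert v S) =
        t.whiteFrontier (insert v S) := by
      refine Finset.union_eq_right.2 fun u hu => ?_
      simp only [OTree.whiteFrontier, Finset.mem_filter, Finset.mem_insert] at hu ⊢
      refine ⟨hu.1, hu.2.1, ?_, .inr hu.2.2.2⟩
      rintro (rfl | h)
      · tauto
      · exact hu.2.2.1 h
    rw [hW] at h1 hchild
    have b3 := Finset.card_insert_le v (blackFrontier S)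
    refine (h1.step (.placeBlack _ _ v hv hchild) ?_).removeBlacks ?_ ?_
    · simp only
      omega
    · intro u hu
      simp only [blackFrontier, Finset.mem_filter, Finset.mem_insert] at hu ⊢
      tauto
    · omega
  · push Not at hroot
    have hvW : v ∈ t.whiteFrontier S ∪ t.whiteFrontier (insert v S) :=
      Finset.mem_union_left _ (Finset.mem_filter.2 ⟨OTree.mem_nodes.2 hv, hroot.1, hvS, hroot.2⟩)
    have hW : (t.whiteFrontier S ∪ t.whiteFrontier (insert v S)).erase v =
        t.whiteFrontier (insert v S) := by
      ext u
      simp only [OTree.whiteFrontier, Finset.mem_filter, Finset.mem_insert, Finset.mem_union,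
        Finset.mem_erase]
      tauto
    have h2 := PMove.removeWhite (t := t) _ _ v hvW hchild
    rw [hW] at h2
    refine (h1.step h2 ?_).removeBlacks ?_ ?_
    · simp only
      omega
    · intro u hu
      simp only [blackFrontier, Finset.mem_filter, Finset.mem_insert] at hu ⊢
      rcases hu with ⟨rfl | hu, h⟩
      · tauto
      · tauto
    · omega

theorem OTree.IsListing.exists_pebbleReach {t : OTree} {l : List (List ℕ)} (hl : t.IsListing l)
    {k : ℕ} (hk : ∀ n, (t.cut (l.take n).toFinset).card ≤ k) :
    ∃ B : Finset (List ℕ), [] ∈ B ∧ PebbleReach t (3 * k + 2) (B, ∅) := by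
  have key : ∀ n ≤ l.length, PebbleReach t (3 * k + 2)
      (blackFrontier (l.take n).toFinset, t.whiteFrontier (l.take n).toFinset) := by
    intro n
    induction n with
    | zero =>
      intro _
      simpa [blackFrontier, OTree.whiteFrontier] using PebbleReach.empty t (3 * k + 2)
    | succ n ih =>
      intro hn
      have hsucc : (l.take (n + 1)).toFinset = insert l[n] (l.take n).toFinset := by
        rw [List.take_succ_eq_append_getElem (show n < l.length by omega), List.toFinset_append]
        rw [List.toFinset_cons, List.toFinset_nil, insert_empty_eq, Finset.union_comm,
          Finset.insert_eq]
      have hc' := hk (n + 1)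
      rw [hsucc] at hc' ⊢
      refine PebbleReach.advance ?_ ((hl.2 _).1 (List.getElem_mem _)) ?_ (hk n) hc' (ih (by omega))
      · intro u hu
        exact (hl.2 u).1 (List.mem_of_mem_take (List.mem_toFinset.1 hu))
      · have h1 : (l.take (n + 1)).Nodup := hl.1.sublist (List.take_sublist _ _)
        rw [List.take_succ_eq_append_getElem (by omega), List.nodup_append] at h1
        exact fun h => h1.2.2 _ (List.mem_toFinset.1 h) _ (by simp) rfl
  have h := key l.length le_rfl
  rw [List.take_length] at h
  have hW : t.whiteFrontier l.toFinset = ∅ := by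
    refine Finset.filter_eq_empty_iff.2 fun v hv => ?_
    have : v ∈ l.toFinset := List.mem_toFinset.2 ((hl.2 v).2 (OTree.mem_nodes.1 hv))
    tauto
  rw [hW] at h
  refine ⟨_, Finset.mem_filter.2 ⟨?_, .inl rfl⟩, h⟩
  exact List.mem_toFinset.2 ((hl.2 _).2 (.nil t))

/-- A move from `c` to `d` settles `v` if it puts a black pebble on `v` or takes a white one. -/
def Settles (c d : Finset (List ℕ) × Finset (List ℕ)) (v : List ℕ) : Prop :=
  (v ∉ c.1 ∧ v ∈ d.1) ∨ (v ∈ c.2 ∧ v ∉ d.2)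

theorem PMove.settles_unique {t : OTree} {c d : Finset (List ℕ) × Finset (List ℕ)} {u v : List ℕ}
    (h : PMove t c d) (hu : Settles c d u) (hv : Settles c d v) : u = v := by
  cases h <;> simp only [Settles, Finset.mem_insert, Finset.mem_erase] at hu hv <;> grind

theorem PMove.child_mem {t : OTree} {c d : Finset (List ℕ) × Finset (List ℕ)} {v : List ℕ}
    (h : PMove t c d) (hv : Settles c d v) {i : ℕ} (hi : TreeNode t (v ++ [i])) :
    v ++ [i] ∈ c.1 ∪ c.2 := by
  cases h with
  | placeBlack B W u hu h =>
    obtain rfl : v = u := by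
      simp only [Settles, Finset.mem_insert] at hv
      tauto
    exact h i hi
  | removeBlack B W u hu => simp [Settles] at hv; tauto
  | placeWhite B W u hu => simp [Settles] at hv; tauto
  | removeWhite B W u hu h =>
    obtain rfl : v = u := by
      simp only [Settles, Finset.mem_erase] at hv
      tauto
    exact h i hi

theorem Nat.exists_last_switch_on {p : ℕ → Prop} (h0 : ¬ p 0) {i : ℕ} (hi : p i) :
    ∃ j < i, ¬ p j ∧ ∀ m, j < m → m ≤ i → p m := by
  induction i with
  | zero => exact absurd hi h0
  | succ i ih =>
    by_cases h : p i
    · obtain ⟨j, hj, hpj, hm⟩ := ih h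
      refine ⟨j, by omega, hpj, fun m h1 h2 => ?_⟩
      rcases Nat.le_succ_iff.1 h2 with h2 | rfl
      · exact hm m h1 h2
      · exact hi
    · refine ⟨i, by omega, h, fun m h1 h2 => ?_⟩
      obtain rfl : m = i + 1 := by omega
      exact hi

theorem Nat.exists_first_switch_off {p : ℕ → Prop} {i n : ℕ} (hi : p i) (hin : i ≤ n)
    (hn : ¬ p n) : ∃ j < n, i ≤ j ∧ ¬ p (j + 1) ∧ ∀ m, i ≤ m → m ≤ j → p m := by
  classical
  obtain ⟨d, rfl⟩ := Nat.exists_eq_add_of_le hin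
  have hex : ∃ d, ¬ p (i + d) := ⟨d, hn⟩
  have hpos : 0 < Nat.find hex := Nat.pos_of_ne_zero fun h => by
    have := Nat.find_spec hex
    rw [h] at this
    exact this hi
  have hle : Nat.find hex ≤ d := Nat.find_min' hex hn
  refine ⟨i + (Nat.find hex - 1), by omega, by omega, ?_, fun m h1 h2 => ?_⟩
  · rw [add_assoc, Nat.sub_add_cancel hpos]
    exact Nat.find_spec hex
  · obtain ⟨e, rfl⟩ := Nat.exists_eq_add_of_le h1
    exact not_not.1 (Nat.find_min hex (m := e) (by omega))

theorem exists_snoc_rec {α β : Type*} (a : β) (g : List α → α → β → β) :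
    ∃ T : List α → β, T [] = a ∧ ∀ v x, T (v ++ [x]) = g v x (T v) :=
  ⟨fun v => List.rec (motive := fun _ => β) a (fun x l ih => g l.reverse x ih) v.reverse, rfl,
    by intros; simp⟩

theorem OTree.exists_isListing_of_moves {t : OTree} {k n : ℕ}
    {c : ℕ → Finset (List ℕ) × Finset (List ℕ)} (h0 : c 0 = (∅, ∅))
    (hstep : ∀ i < n, PMove t (c i) (c (i + 1))) (hroot : [] ∈ (c n).1) (hwhite : (c n).2 = ∅)
    (hk : ∀ i ≤ n, (c i).1.card + (c i).2.card ≤ k) :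
    ∃ l, t.IsListing l ∧ ∀ m, (t.cut (l.take m).toFinset).card ≤ k := by
  have hr : ∃ i < n, Settles (c i) (c (i + 1)) [] := by
    obtain ⟨j, hj, h1, h2⟩ := Nat.exists_last_switch_on (p := fun i => [] ∈ (c i).1)
      (by simp [h0]) hroot
    exact ⟨j, hj, .inl ⟨h1, h2 _ (by omega) (by omega)⟩⟩
  have hchild : ∀ (v : List ℕ) (x i : ℕ), TreeNode t (v ++ [x]) → i < n →
      Settles (c i) (c (i + 1)) v → ∃ j < n, Settles (c j) (c (j + 1)) (v ++ [x]) ∧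
        ∀ m, (j < m ∧ m ≤ i) ∨ (i < m ∧ m ≤ j) → v ++ [x] ∈ (c m).1 ∪ (c m).2 := by
    intro v x i hx hi hs
    rcases Finset.mem_union.1 ((hstep i hi).child_mem hs hx) with h | h
    · obtain ⟨j, hj, h1, h2⟩ := Nat.exists_last_switch_on (p := fun i => v ++ [x] ∈ (c i).1)
        (by simp [h0]) h
      refine ⟨j, by omega, .inl ⟨h1, h2 _ (by omega) (by omega)⟩, fun m hm => ?_⟩
      exact Finset.mem_union_left _ (h2 m (by omega) (by omega))
    · obtain ⟨j, hj, hij, h1, h2⟩ := Nat.exists_first_switch_off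
        (p := fun i => v ++ [x] ∈ (c i).2) h hi.le (by simp [hwhite])
      refine ⟨j, by omega, .inr ⟨h2 _ hij le_rfl, h1⟩, fun m hm => ?_⟩
      exact Finset.mem_union_right _ (h2 m (by omega) (by omega))
  obtain ⟨r, hr1, hr2⟩ := hr
  choose! g hg1 hg2 hg3 using hchild
  obtain ⟨T, hT1, hT2⟩ := exists_snoc_rec r g
  have hT : ∀ v, TreeNode t v → T v < n ∧ Settles (c (T v)) (c (T v + 1)) v := by
    intro v
    induction v using List.reverseRecOn with
    | nil => intro _; rw [hT1]; exact ⟨hr1, hr2⟩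
    | append_singleton v x ih =>
      intro h
      obtain ⟨h1, h2⟩ := ih h.of_append
      rw [hT2]
      exact ⟨hg1 v x _ h h1 h2, hg2 v x _ h h1 h2⟩
  have hinj : ∀ u v, TreeNode t u → TreeNode t v → T u = T v → u = v := by
    intro u v hu hv huv
    have h1 := (hT u hu).2
    rw [huv] at h1
    exact (hstep _ (hT v hv).1).settles_unique h1 (hT v hv).2
  have hperm := List.mergeSort_perm t.nodes.toList (fun a b => decide (T a ≤ T b))
  have hsort : (t.nodes.toList.mergeSort (fun a b => decide (T a ≤ T b))).Pairwise
      (fun a b => T a ≤ T b) := by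
    have := List.pairwise_mergeSort (le := fun a b => decide (T a ≤ T b))
      (by simp only [decide_eq_true_eq]; intros; omega)
      (by simp only [Bool.or_eq_true, decide_eq_true_eq]; intros; omega) t.nodes.toList
    simpa using this
  generalize t.nodes.toList.mergeSort (fun a b => decide (T a ≤ T b)) = l at hperm hsort
  have hl : t.IsListing l :=
    ⟨hperm.nodup_iff.2 (Finset.nodup_toList _), fun v => by
      rw [hperm.mem_iff, Finset.mem_toList, OTree.mem_nodes]⟩
  refine ⟨l, hl, fun s => ?_⟩
  have hsplit : ∃ m ≤ n, ∀ v, TreeNode t v → (v ∈ l.take s ↔ T v < m) := by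
    rcases Nat.lt_or_ge s l.length with hs | hs
    · have hns := (hl.2 _).1 (List.getElem_mem hs)
      refine ⟨T l[s], (hT _ hns).1.le, fun v hv => ?_⟩
      have hpair := hsort
      have hnodup := hl.1
      rw [← List.take_append_drop s l, List.drop_eq_getElem_cons hs] at hpair hnodup
      rw [List.pairwise_append, List.pairwise_cons] at hpair
      rw [List.nodup_append] at hnodup
      constructor
      · intro h
        refine lt_of_le_of_ne (hpair.2.2 v h _ List.mem_cons_self) fun heq => ?_
        exact hnodup.2.2 v h _ List.mem_cons_self (hinj _ _ hv hns heq)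
      · intro h
        by_contra hnot
        have hmem := (hl.2 v).2 hv
        rw [← List.take_append_drop s l, List.drop_eq_getElem_cons hs] at hmem
        rcases List.mem_append.1 hmem with h' | h'
        · exact hnot h'
        · rcases List.mem_cons.1 h' with rfl | h'
          · exact lt_irrefl _ h
          · exact absurd (hpair.2.1.1 v h') (by omega)
    · refine ⟨n, le_rfl, fun v hv => ?_⟩
      rw [List.take_of_length_le hs, hl.2]
      exact ⟨fun _ => (hT v hv).1, fun _ => hv⟩
  obtain ⟨m, hmn, hm⟩ := hsplit
  have hsub : t.cut (l.take s).toFinset ⊆ (c m).1 ∪ (c m).2 := by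
    intro v hv
    obtain rfl | ⟨v, x, rfl⟩ := v.eq_nil_or_concat'
    · simp [OTree.cut] at hv
    · obtain ⟨h1, h2⟩ := OTree.mem_cut.1 hv
      rw [List.mem_toFinset, List.mem_toFinset, hm _ h1, hm _ h1.of_append, hT2] at h2
      obtain ⟨h3, h4⟩ := hT v h1.of_append
      exact hg3 v x _ h1 h3 h4 m (by omega)
  exact (Finset.card_le_card hsub).trans ((Finset.card_union_le _ _).trans (hk m hmn))

theorem OTree.IsListing.bw_le {t : OTree} {l : List (List ℕ)} (hl : t.IsListing l) {k : ℕ}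
    (hk : ∀ n, (t.cut (l.take n).toFinset).card ≤ k) : bw t ≤ 3 * k + 2 := by
  obtain ⟨B, hB, cs, h1, h2, h3, h4⟩ := hl.exists_pebbleReach hk
  exact Nat.sInf_le ⟨cs, h1, h2, ⟨_, h3, hB, rfl⟩, h4⟩

theorem OTree.exists_isListing_card_cut_le_bw (t : OTree) :
    0 < bw t ∧ ∃ l, t.IsListing l ∧ ∀ n, (t.cut (l.take n).toFinset).card ≤ bw t := by
  have hne : ∃ k, ∃ cs : List (Finset (List ℕ) × Finset (List ℕ)), cs.IsChain (PMove t) ∧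
      cs.head? = some (∅, ∅) ∧ (∃ last, cs.getLast? = some last ∧ [] ∈ last.1 ∧ last.2 = ∅) ∧
      ∀ c ∈ cs, c.1.card + c.2.card ≤ k := by
    obtain ⟨B, hB, cs, h1, h2, h3, h4⟩ := t.isListing_toList_nodes.exists_pebbleReach
      (k := t.nodes.card) fun n => Finset.card_filter_le _ _
    exact ⟨_, cs, h1, h2, ⟨_, h3, hB, rfl⟩, h4⟩
  obtain ⟨cs, h1, h2, ⟨last, h3, hroot, hwhite⟩, h4⟩ := Nat.sInf_mem hne
  change ∀ c ∈ cs, c.1.card + c.2.card ≤ bw t at h4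
  have hlast : last ∈ cs := List.mem_of_getLast? h3
  have hlen : 0 < cs.length := List.length_pos_of_mem hlast
  have hget : ∀ i (h : i < cs.length), cs.getD i (∅, ∅) = cs[i] :=
    fun i h => List.getD_eq_getElem _ _ h
  have hend : cs.getD (cs.length - 1) (∅, ∅) = last := by
    rw [List.getLast?_eq_getElem?] at h3
    simp [List.getD_eq_getElem?_getD, h3]
  refine ⟨lt_of_lt_of_le ?_ (h4 last hlast),
    OTree.exists_isListing_of_moves (c := fun i => cs.getD i (∅, ∅)) (n := cs.length - 1)
      ?_ ?_ ?_ ?_ ?_⟩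
  · have := Finset.card_pos.2 ⟨_, hroot⟩
    omega
  · rw [List.head?_eq_getElem?] at h2
    simp [List.getD_eq_getElem?_getD, h2]
  · intro i hi
    have := List.isChain_iff_getElem.1 h1 i (by omega)
    rwa [hget i (by omega), hget (i + 1) (by omega)]
  · simpa only [hend] using hroot
  · simpa only [hend] using hwhite
  · intro i hi
    rw [hget i (by omega)]
    exact h4 _ (List.getElem_mem _)

/-- For Dyck primes whose associated ordered rooted tree is binary, the minimum
width of a simple re-pairing is Θ(bw(D)), where bw is the black-and-white
pebbling number of the associated tree. -/
theorem simpleWidth_theta_bw : ∃ c₁ c₂ : ℝ, 0 < c₁ ∧ 0 < c₂ ∧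
    ∀ t : OTree, Binary t →
      c₁ * (bw t : ℝ) ≤ (simpleWidth (treeWord t) : ℝ) ∧
      (simpleWidth (treeWord t) : ℝ) ≤ c₂ * (bw t : ℝ) := by
  refine ⟨1 / 14, 3, by norm_num, by norm_num, fun t ht => ?_⟩
  obtain ⟨hpos, l, hl, hk⟩ := OTree.exists_isListing_card_cut_le ht
  obtain ⟨hpos', l', hl', hk'⟩ := t.exists_isListing_card_cut_le_bw
  have h1 : bw t ≤ 14 * simpleWidth (treeWord t) := by
    have := hl.bw_le hk
    omega
  have h2 : simpleWidth (treeWord t) ≤ 3 * bw t := by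
    have := hl'.simpleWidth_le hk'
    omega
  have h1' : (bw t : ℝ) ≤ 14 * simpleWidth (treeWord t) := by exact_mod_cast h1
  have h2' : (simpleWidth (treeWord t) : ℝ) ≤ 3 * bw t := by exact_mod_cast h2
  constructor
  · linarith
  · exact h2'
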